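/- arXiv:2205.06387 — 2 statements merged into one kernel-verified Lean document; each statement's English description precedes it below -/
import Mathlib

section
/- Let q⁽¹⁾, q⁽²⁾ be collision kernels of the form q⁽ʲ⁾(θ,ρ) = ρ^{γⱼ} q₀⁽ʲ⁾(θ) with 0 ≤ γⱼ ≤ 1 and q₀⁽ʲ⁾ : [0,π/2] → [0,∞) measurable with 0 ≤ q₀⁽ʲ⁾(θ) ≤ C cos θ, and let q̃⁽ʲ⁾ and k₂⁽ʲ⁾ be the associated functions. If k₂⁽¹⁾(u,v) = k₂⁽²⁾(u,v) for all u ≠ v in ℝ³, then for every ρ > 0, q̃⁽¹⁾(ρ, r) = q̃⁽²⁾(ρ, r) for almost every r > 0. -/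
open MeasureTheory Real Metric
open scoped RealInnerProductSpace

noncomputable section

lemma exp_neg_norm_add_sq
    {E : Type*} [NormedAddCommGroup E] [InnerProductSpace ℝ E] (y z : E) :
    exp (-‖y + z‖ ^ 2) = exp (-‖z‖ ^ 2) * (exp (-‖y‖ ^ 2) * exp ⟪y, (-2 : ℝ) • z⟫) := by
  rw [← exp_add, ← exp_add, norm_add_sq_real, real_inner_smul_right]
  ring_nf

section GaussWeierstrass

variable {E : Type*} [NormedAddCommGroup E] [InnerProductSpace ℝ E] [FiniteDimensional ℝ E]
  [MeasurableSpace E] [BorelSpace E]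

/-- Finite measures on a Euclidean space whose Laplace transforms are finite everywhere and
coincide are equal. -/
lemma measure_ext_of_integral_exp_inner {μ ν : Measure E} [IsFiniteMeasure μ] [IsFiniteMeasure ν]
    (hμ : ∀ t : E, Integrable (fun x ↦ exp ⟪x, t⟫) μ)
    (h : ∀ t : E, ∫ x, exp ⟪x, t⟫ ∂μ = ∫ x, exp ⟪x, t⟫ ∂ν) : μ = ν := by
  refine Measure.ext_of_charFun (funext fun t ↦ ?_)
  have hmgf : ProbabilityTheory.mgf (fun x ↦ ⟪x, t⟫) μ
      = ProbabilityTheory.mgf (fun x ↦ ⟪x, t⟫) ν := by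
    ext s
    simpa only [ProbabilityTheory.mgf, real_inner_smul_right] using h (s • t)
  have hzero : μ = 0 ↔ ν = 0 := by
    have h0 : μ.real Set.univ = ν.real Set.univ := by simpa using h 0
    rw [← Measure.measure_univ_eq_zero, ← Measure.measure_univ_eq_zero,
      ← measureReal_eq_zero_iff, ← measureReal_eq_zero_iff, h0]
  have hset : ProbabilityTheory.integrableExpSet (fun x ↦ ⟪x, t⟫) μ = Set.univ :=
    Set.eq_univ_of_forall fun s ↦ by
      simpa only [ProbabilityTheory.integrableExpSet, Set.mem_ofPred_eq, real_inner_smul_right]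
        using hμ (s • t)
  have key := ProbabilityTheory.eqOn_complexMGF_of_mgf' hmgf hzero
    (x := Complex.I) (by simp [hset])
  simpa only [ProbabilityTheory.complexMGF, charFun_apply, mul_comm Complex.I] using key

lemma integrable_exp_neg_norm_add_sq (z : E) :
    Integrable (fun y : E ↦ exp (-‖y + z‖ ^ 2)) := by
  have h := (GaussianFourier.integrable_cexp_neg_mul_sq_norm_add (V := E) (b := 1)
    (by simp) 0 0).norm
  have h' : Integrable (fun y : E ↦ exp (-‖y‖ ^ 2)) := by
    refine h.congr (.of_forall fun y ↦ ?_)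
    simp [Complex.norm_exp, ← Complex.ofReal_pow]
  exact h'.comp_add_right z

/-- Injectivity of the Gauss–Weierstrass transform on bounded nonnegative functions. -/
lemma ae_eq_of_integral_gaussian_eq {f g : E → ℝ} {M : ℝ} (hf : Measurable f) (hg : Measurable g)
    (hf0 : ∀ y, 0 ≤ f y) (hg0 : ∀ y, 0 ≤ g y) (hfM : ∀ y, f y ≤ M) (hgM : ∀ y, g y ≤ M)
    (h : ∀ z : E, ∫ y, exp (-‖y + z‖ ^ 2) * f y = ∫ y, exp (-‖y + z‖ ^ 2) * g y) :
    f =ᵐ[volume] g := by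
  have key : ∀ {f : E → ℝ}, Measurable f → (∀ y, 0 ≤ f y) → (∀ y, f y ≤ M) →
      ∀ t : E, Integrable (fun y ↦ exp (-‖y‖ ^ 2) * f y * exp ⟪y, t⟫) := by
    intro f hf hf0 hfM t
    have h1 : Integrable (fun y : E ↦ exp (-‖y + (-2⁻¹ : ℝ) • t‖ ^ 2) * f y) :=
      (integrable_exp_neg_norm_add_sq _).mul_bdd hf.aestronglyMeasurable
        (.of_forall fun y ↦ by rw [Real.norm_of_nonneg (hf0 y)]; exact hfM y)
    refine (h1.const_mul (exp (-‖(-2⁻¹ : ℝ) • t‖ ^ 2))⁻¹).congr (.of_forall fun y ↦ ?_)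
    have ht : (-2 : ℝ) • (-2⁻¹ : ℝ) • t = t := by rw [smul_smul]; norm_num
    simp only [exp_neg_norm_add_sq, ht]
    field_simp
  have hwd : ∀ {f : E → ℝ}, Measurable f → (∀ y, 0 ≤ f y) → ∀ G : E → ℝ,
      ∫ y, G y ∂volume.withDensity (fun y ↦ ENNReal.ofReal (exp (-‖y‖ ^ 2) * f y))
        = ∫ y, exp (-‖y‖ ^ 2) * f y * G y := by
    intro f hf hf0 G
    rw [integral_withDensity_eq_integral_toReal_smul (by fun_prop) (by simp)]
    refine integral_congr_ae (.of_forall fun y ↦ ?_)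
    simp only [smul_eq_mul]
    rw [ENNReal.toReal_ofReal (mul_nonneg (exp_pos _).le (hf0 y))]
  have hfin : ∀ {f : E → ℝ}, Measurable f → (∀ y, 0 ≤ f y) → (∀ y, f y ≤ M) →
      ∫⁻ y, ENNReal.ofReal (exp (-‖y‖ ^ 2) * f y) ≠ ⊤ := by
    intro f hf hf0 hfM
    have := key hf hf0 hfM 0
    simp only [inner_zero_right, exp_zero, mul_one] at this
    exact this.lintegral_lt_top.ne
  have : IsFiniteMeasure
      ((volume : Measure E).withDensity fun y ↦ ENNReal.ofReal (exp (-‖y‖ ^ 2) * f y)) :=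
    isFiniteMeasure_withDensity (hfin hf hf0 hfM)
  have : IsFiniteMeasure
      ((volume : Measure E).withDensity fun y ↦ ENNReal.ofReal (exp (-‖y‖ ^ 2) * g y)) :=
    isFiniteMeasure_withDensity (hfin hg hg0 hgM)
  have hmeas := measure_ext_of_integral_exp_inner
    (μ := volume.withDensity fun y ↦ ENNReal.ofReal (exp (-‖y‖ ^ 2) * f y))
    (ν := volume.withDensity fun y ↦ ENNReal.ofReal (exp (-‖y‖ ^ 2) * g y)) ?_ ?_
  · rw [withDensity_eq_iff (by fun_prop) (by fun_prop) (hfin hf hf0 hfM)] at hmeas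
    filter_upwards [hmeas] with y hy
    rw [ENNReal.ofReal_eq_ofReal_iff (mul_nonneg (exp_pos _).le (hf0 y))
      (mul_nonneg (exp_pos _).le (hg0 y))] at hy
    exact mul_left_cancel₀ (exp_pos _).ne' hy
  · intro t
    rw [integrable_withDensity_iff_integrable_smul' (by fun_prop) (by simp)]
    refine (key hf hf0 hfM t).congr (.of_forall fun y ↦ ?_)
    simp only [smul_eq_mul]
    rw [ENNReal.toReal_ofReal (mul_nonneg (exp_pos _).le (hf0 y))]
  · intro t
    rw [hwd hf hf0, hwd hg hg0]
    have ht : (-2 : ℝ) • (-2⁻¹ : ℝ) • t = t := by rw [smul_smul]; norm_num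
    have ht' := h ((-2⁻¹ : ℝ) • t)
    simp only [exp_neg_norm_add_sq, ht, mul_assoc, integral_const_mul] at ht'
    have := mul_left_cancel₀ (exp_pos _).ne' ht'
    simpa only [mul_assoc, mul_comm (exp ⟪_, _⟫)] using this

/-- Radial functions that agree almost everywhere have almost everywhere equal profiles. -/
lemma ae_eq_of_fun_norm_ae_eq [Nontrivial E] {f g : ℝ → ℝ} (hf : Measurable f) (hg : Measurable g)
    (h : ∀ᵐ y : E, f ‖y‖ = g ‖y‖) :
    ∀ᵐ r ∂volume.restrict (Set.Ioi (0 : ℝ)), f r = g r := by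
  let s : Set ℝ := {r | f r ≠ g r}
  have hs : MeasurableSet s := (measurableSet_eq_fun hf hg).compl
  let φ : ℝ → ℝ := s.indicator 1
  have hφ : (fun y : E ↦ φ ‖y‖) =ᵐ[volume] 0 := by
    filter_upwards [h] with y hy
    simp [φ, s, hy]
  have hint : IntegrableOn (fun r : ℝ ↦ r ^ (Module.finrank ℝ E - 1) • φ r) (Set.Ioi 0) := by
    rw [← integrable_fun_norm_addHaar (volume : Measure E)]
    exact (integrable_zero E ℝ volume).congr hφ.symm
  have hzero : ∫ r in Set.Ioi (0 : ℝ), r ^ (Module.finrank ℝ E - 1) • φ r = 0 := by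
    have := integral_fun_norm_addHaar (volume : Measure E) φ
    rw [integral_eq_zero_of_ae hφ] at this
    have hball : (volume : Measure E).real (ball 0 1) ≠ 0 :=
      (ENNReal.toReal_pos (measure_ball_pos _ _ one_pos).ne' measure_ball_lt_top.ne).ne'
    have hd : Module.finrank ℝ E ≠ 0 := Module.finrank_pos.ne'
    simpa [hball, hd] using this.symm
  rw [setIntegral_eq_zero_iff_of_nonneg_ae _ hint] at hzero
  · rw [Filter.EventuallyEq] at hzero
    filter_upwards [hzero, ae_restrict_mem measurableSet_Ioi] with r hr hr0
    by_contra hne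
    have : φ r = 1 := by simp [φ, s, hne]
    simp [this, (Set.mem_Ioi.1 hr0).ne'] at hr
  · filter_upwards [ae_restrict_mem measurableSet_Ioi] with r hr0
    exact smul_nonneg (pow_nonneg (Set.mem_Ioi.1 hr0).le _)
      (Set.indicator_nonneg (fun _ _ ↦ zero_le_one) _)

end GaussWeierstrass

/-- On each vertical line, the Cartesian form of a kernel `ρ ^ γ * q₀ θ` obeying Grad's cutoff
agrees on `(0, ∞)` with a bounded nonnegative measurable function. -/
lemma exists_bounded_profile {γ C : ℝ} (hγ : γ ∈ Set.Icc (0 : ℝ) 1) {q₀ : ℝ → ℝ}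
    (hm : Measurable q₀)
    (hq₀ : ∀ θ ∈ Set.Icc 0 (π / 2), 0 ≤ q₀ θ ∧ q₀ θ ≤ C * Real.cos θ)
    {qt : ℝ → ℝ → ℝ}
    (hqt : ∀ θ ∈ Set.Ioo 0 (π / 2), ∀ ρ > (0 : ℝ),
      qt (ρ * Real.cos θ) (ρ * Real.sin θ)
        = (1 / 2 * (ρ ^ γ * q₀ θ * Real.sin θ
            + ρ ^ γ * q₀ (π / 2 - θ) * Real.sin (π / 2 - θ))) / Real.sin θ)
    {ρ : ℝ} (hρ : 0 < ρ) :
    ∃ F : ℝ → ℝ, Measurable F ∧ (∀ r, 0 ≤ F r) ∧ (∃ M, ∀ r, F r ≤ M) ∧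
      ∀ r > 0, qt ρ r = F r := by
  let R : ℝ → ℝ := fun r ↦ √(1 + (r / ρ) ^ 2) * ρ
  let G : ℝ → ℝ := fun r ↦
    (1 / 2 * (R r ^ γ * q₀ (arctan (r / ρ)) * Real.sin (arctan (r / ρ))
      + R r ^ γ * q₀ (π / 2 - arctan (r / ρ)) * Real.sin (π / 2 - arctan (r / ρ))))
      / Real.sin (arctan (r / ρ))
  have hGm : Measurable G := by fun_prop
  have hRpos (r : ℝ) : 0 < R r := by positivity
  have hθ {r : ℝ} (hr : 0 < r) : arctan (r / ρ) ∈ Set.Ioo 0 (π / 2) :=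
    ⟨arctan_pos.2 (div_pos hr hρ), arctan_lt_pi_div_two _⟩
  have hRcos (r : ℝ) : R r * Real.cos (arctan (r / ρ)) = ρ := by
    simp only [R, cos_arctan]
    field_simp
  have hG {r : ℝ} (hr : 0 < r) : qt ρ r = G r := by
    have h := hqt _ (hθ hr) (R r) (hRpos r)
    have hRsin : R r * Real.sin (arctan (r / ρ)) = r := by
      simp only [R, sin_arctan]
      field_simp
    rwa [hRcos, hRsin] at h
  have hbound {r : ℝ} (hr : 0 < r) : 0 ≤ G r ∧ G r ≤ C * ρ ^ γ := by
    have hθr := hθ hr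
    have hRcosr := hRcos r
    have hRr := hRpos r
    simp only [G]
    set θ := arctan (r / ρ)
    have hsin : 0 < Real.sin θ := sin_pos_of_pos_of_lt_pi hθr.1 (by linarith [hθr.2, pi_pos])
    have hcos : 0 < Real.cos θ := cos_pos_of_mem_Ioo ⟨by linarith [hθr.1, pi_pos], hθr.2⟩
    obtain ⟨ha0, ha⟩ := hq₀ θ ⟨hθr.1.le, hθr.2.le⟩
    obtain ⟨hb0, hb⟩ := hq₀ (π / 2 - θ) ⟨by linarith [hθr.2], by linarith [hθr.1]⟩
    rw [cos_pi_div_two_sub] at hb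
    rw [sin_pi_div_two_sub]
    have hC : 0 ≤ C := nonneg_of_mul_nonneg_left (ha0.trans ha) hcos
    have hpow : 0 ≤ R r ^ γ := (rpow_pos_of_pos hRr γ).le
    have hmain : R r ^ γ * Real.cos θ ≤ ρ ^ γ := by
      rw [← hRcosr, mul_rpow hRr.le hcos.le]
      refine mul_le_mul_of_nonneg_left ?_ hpow
      simpa using rpow_le_rpow_of_exponent_ge hcos (cos_le_one θ) hγ.2
    refine ⟨by positivity, ?_⟩
    rw [div_le_iff₀ hsin]
    calc 1 / 2 * (R r ^ γ * q₀ θ * Real.sin θ + R r ^ γ * q₀ (π / 2 - θ) * Real.cos θ)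
        ≤ 1 / 2 * (R r ^ γ * (C * Real.cos θ) * Real.sin θ
          + R r ^ γ * (C * Real.sin θ) * Real.cos θ) := by gcongr
      _ = C * (R r ^ γ * Real.cos θ) * Real.sin θ := by ring
      _ ≤ C * ρ ^ γ * Real.sin θ := by gcongr
  refine ⟨(Set.Ioi 0).indicator G, hGm.indicator measurableSet_Ioi,
    Set.indicator_nonneg fun r hr ↦ (hbound hr).1, ⟨max (C * ρ ^ γ) 0, fun r ↦ ?_⟩, fun r hr ↦ ?_⟩
  · by_cases hr : r ∈ Set.Ioi (0 : ℝ)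
    · rw [Set.indicator_of_mem hr]
      exact (hbound hr).2.trans (le_max_left _ _)
    · rw [Set.indicator_of_notMem hr]
      exact le_max_right _ _
  · rw [Set.indicator_of_mem (Set.mem_Ioi.2 hr), hG hr]

/-- **The kernel `k₂` determines `q̃`.** For two collision kernels
`q⁽ʲ⁾(θ,ρ) = ρ^{γⱼ} q₀⁽ʲ⁾(θ)` satisfying Grad's cutoff, with associated Cartesian
representations `q̃⁽ʲ⁾` (defined by `q̃(ρcosθ, ρsinθ) = B̃(θ,ρ)/sinθ`,
`B̃(θ,ρ) = ½[B(θ,ρ)+B(π/2−θ,ρ)]`, `B(θ,ρ) = q(θ,ρ)sinθ`) and kernels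
`k₂⁽ʲ⁾(u,v) = (2/|u−v|²) e^{−|u−v|²/4} ∫_Π e^{−|y+ζ|²} q̃⁽ʲ⁾(|u−v|,|y|) dΠ(y)`
(`ζ = (u+v)/2`, `Π = {y : y·(u−v)=0}` with 2-dim Lebesgue measure), equality
`k₂⁽¹⁾ = k₂⁽²⁾` on `u ≠ v` implies `q̃⁽¹⁾(ρ,·) = q̃⁽²⁾(ρ,·)` a.e. on `(0,∞)` for
every `ρ > 0`. -/
theorem k2_determines_qtilde
    (γ₁ γ₂ C : ℝ) (hγ₁ : γ₁ ∈ Set.Icc (0 : ℝ) 1) (hγ₂ : γ₂ ∈ Set.Icc (0 : ℝ) 1) (hC : 0 < C)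
    (q₀₁ q₀₂ : ℝ → ℝ) (hq₀₁m : Measurable q₀₁) (hq₀₂m : Measurable q₀₂)
    (hq₀₁ : ∀ θ ∈ Set.Icc 0 (π / 2), 0 ≤ q₀₁ θ ∧ q₀₁ θ ≤ C * Real.cos θ)
    (hq₀₂ : ∀ θ ∈ Set.Icc 0 (π / 2), 0 ≤ q₀₂ θ ∧ q₀₂ θ ≤ C * Real.cos θ)
    (qt₁ qt₂ : ℝ → ℝ → ℝ)
    (hqt₁ : ∀ θ ∈ Set.Ioo 0 (π / 2), ∀ ρ > (0 : ℝ),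
      qt₁ (ρ * Real.cos θ) (ρ * Real.sin θ)
        = (1 / 2 * (ρ ^ γ₁ * q₀₁ θ * Real.sin θ
            + ρ ^ γ₁ * q₀₁ (π / 2 - θ) * Real.sin (π / 2 - θ))) / Real.sin θ)
    (hqt₂ : ∀ θ ∈ Set.Ioo 0 (π / 2), ∀ ρ > (0 : ℝ),
      qt₂ (ρ * Real.cos θ) (ρ * Real.sin θ)
        = (1 / 2 * (ρ ^ γ₂ * q₀₂ θ * Real.sin θ
            + ρ ^ γ₂ * q₀₂ (π / 2 - θ) * Real.sin (π / 2 - θ))) / Real.sin θ)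
    (hk : ∀ u v : EuclideanSpace ℝ (Fin 3), u ≠ v →
      (2 / ‖u - v‖ ^ 2) * Real.exp (-‖u - v‖ ^ 2 / 4) *
        ∫ y : ((ℝ ∙ (u - v))ᗮ),
          Real.exp (-‖(y : EuclideanSpace ℝ (Fin 3)) + (2⁻¹ : ℝ) • (u + v)‖ ^ 2)
            * qt₁ ‖u - v‖ ‖(y : EuclideanSpace ℝ (Fin 3))‖
      = (2 / ‖u - v‖ ^ 2) * Real.exp (-‖u - v‖ ^ 2 / 4) *
        ∫ y : ((ℝ ∙ (u - v))ᗮ),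
          Real.exp (-‖(y : EuclideanSpace ℝ (Fin 3)) + (2⁻¹ : ℝ) • (u + v)‖ ^ 2)
            * qt₂ ‖u - v‖ ‖(y : EuclideanSpace ℝ (Fin 3))‖) :
    ∀ ρ > (0 : ℝ), ∀ᵐ r ∂(volume.restrict (Set.Ioi (0 : ℝ))), qt₁ ρ r = qt₂ ρ r := by
  intro ρ hρ
  obtain ⟨F₁, hF₁m, hF₁0, ⟨M₁, hF₁M⟩, hF₁⟩ := exists_bounded_profile hγ₁ hq₀₁m hq₀₁ hqt₁ hρ
  obtain ⟨F₂, hF₂m, hF₂0, ⟨M₂, hF₂M⟩, hF₂⟩ := exists_bounded_profile hγ₂ hq₀₂m hq₀₂ hqt₂ hρ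
  let w : EuclideanSpace ℝ (Fin 3) := EuclideanSpace.single 0 ρ
  have hwnorm : ‖w‖ = ρ := by simp [w, abs_of_pos hρ]
  have hw : w ≠ 0 := by
    rw [← norm_pos_iff, hwnorm]
    exact hρ
  have : Fact (Module.finrank ℝ (EuclideanSpace ℝ (Fin 3)) = 2 + 1) := ⟨by simp⟩
  have hdim : Module.finrank ℝ ((ℝ ∙ w)ᗮ) = 2 := Submodule.finrank_orthogonal_span_singleton hw
  have : Nontrivial ((ℝ ∙ w)ᗮ) := Module.nontrivial_of_finrank_pos (R := ℝ) (by omega)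
  have hne : ∀ᵐ y : (ℝ ∙ w)ᗮ, y ≠ 0 := by simp [ae_iff]
  have htransform (z : (ℝ ∙ w)ᗮ) :
      ∫ y : (ℝ ∙ w)ᗮ, exp (-‖y + z‖ ^ 2) * F₁ ‖y‖
        = ∫ y : (ℝ ∙ w)ᗮ, exp (-‖y + z‖ ^ 2) * F₂ ‖y‖ := by
    have huv : ((z : EuclideanSpace ℝ (Fin 3)) + (2⁻¹ : ℝ) • w)
        - ((z : EuclideanSpace ℝ (Fin 3)) - (2⁻¹ : ℝ) • w) = w := by module
    have hmid : (2⁻¹ : ℝ) • (((z : EuclideanSpace ℝ (Fin 3)) + (2⁻¹ : ℝ) • w)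
        + ((z : EuclideanSpace ℝ (Fin 3)) - (2⁻¹ : ℝ) • w)) = z := by module
    have h := hk ((z : EuclideanSpace ℝ (Fin 3)) + (2⁻¹ : ℝ) • w)
      ((z : EuclideanSpace ℝ (Fin 3)) - (2⁻¹ : ℝ) • w) (by rwa [← sub_ne_zero, huv])
    rw [huv, hmid, hwnorm] at h
    have h := mul_left_cancel₀ (by positivity) h
    convert h using 1
    · refine integral_congr_ae ?_
      filter_upwards [hne] with y hy
      rw [← Submodule.coe_norm y, hF₁ _ (norm_pos_iff.2 hy)]
      rfl
    · refine integral_congr_ae ?_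
      filter_upwards [hne] with y hy
      rw [← Submodule.coe_norm y, hF₂ _ (norm_pos_iff.2 hy)]
      rfl
  have hnorm : ∀ᵐ y : (ℝ ∙ w)ᗮ, F₁ ‖y‖ = F₂ ‖y‖ :=
    ae_eq_of_integral_gaussian_eq (M := max M₁ M₂) (hF₁m.comp measurable_norm)
      (hF₂m.comp measurable_norm) (fun _ ↦ hF₁0 _) (fun _ ↦ hF₂0 _)
      (fun _ ↦ (hF₁M _).trans (le_max_left _ _)) (fun _ ↦ (hF₂M _).trans (le_max_right _ _))
      htransform
  filter_upwards [ae_eq_of_fun_norm_ae_eq hF₁m hF₂m hnorm, ae_restrict_mem measurableSet_Ioi]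
    with r hr hr0
  rw [hF₁ r hr0, hF₂ r hr0, hr]
end
end

section
/- Let q⁽¹⁾, q⁽²⁾ be collision kernels of the form q⁽ʲ⁾(θ,ρ) = ρ^{γⱼ} q₀⁽ʲ⁾(θ) with 0 ≤ γⱼ ≤ 1, q₀⁽ʲ⁾ : [0,π/2] → [0,∞) continuous with 0 ≤ q₀⁽ʲ⁾(θ) ≤ C cos θ, and suppose each satisfies the symmetry assumption B⁽ʲ⁾(θ,ρ) = B⁽ʲ⁾(π/2−θ,ρ) for all θ ∈ (0,π/2), ρ > 0, where B⁽ʲ⁾(θ,ρ) = q⁽ʲ⁾(θ,ρ) sin θ. If the collision frequencies agree, ν⁽¹⁾(v) = ν⁽²⁾(v) for all v ∈ ℝ³, and the kernels agree, k₂⁽¹⁾(u,v) = k₂⁽²⁾(u,v) for all u ≠ v in ℝ³, then q⁽¹⁾(θ,ρ) = q⁽²⁾(θ,ρ) for all θ ∈ (0,π/2) and ρ > 0. -/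
open MeasureTheory Real Metric
open scoped RealInnerProductSpace

noncomputable section

/-- Finite measures on a Hilbert space whose Laplace transforms agree and are finite are equal. -/
theorem MeasureTheory.Measure.ext_of_integral_exp_inner {E : Type*} [NormedAddCommGroup E]
    [InnerProductSpace ℝ E] [CompleteSpace E] [SecondCountableTopology E] [MeasurableSpace E]
    [BorelSpace E] {μ ν : Measure E} [IsFiniteMeasure μ] [IsFiniteMeasure ν]
    (hμ : ∀ t : E, Integrable (fun x ↦ Real.exp ⟪x, t⟫) μ)
    (h : ∀ t : E, ∫ x, Real.exp ⟪x, t⟫ ∂μ = ∫ x, Real.exp ⟪x, t⟫ ∂ν) : μ = ν := by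
  have hzero : μ = 0 ↔ ν = 0 := by
    have h0 := h 0
    simp only [inner_zero_right, Real.exp_zero, integral_const, smul_eq_mul, mul_one] at h0
    rw [← Measure.measure_univ_eq_zero, ← Measure.measure_univ_eq_zero, ← measureReal_eq_zero_iff,
      ← measureReal_eq_zero_iff, h0]
  refine Measure.ext_of_charFun (funext fun t ↦ ?_)
  have hmgf : ProbabilityTheory.mgf (fun x : E ↦ ⟪x, t⟫) μ
      = ProbabilityTheory.mgf (fun x : E ↦ ⟪x, t⟫) ν := by
    ext s
    simpa only [ProbabilityTheory.mgf, inner_smul_right] using h (s • t)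
  have huniv : ProbabilityTheory.integrableExpSet (fun x : E ↦ ⟪x, t⟫) μ = Set.univ :=
    Set.eq_univ_of_forall fun s ↦ by
      simpa only [ProbabilityTheory.integrableExpSet, Set.mem_ofPred_eq, inner_smul_right]
        using hμ (s • t)
  have key := ProbabilityTheory.eqOn_complexMGF_of_mgf' hmgf hzero
    (x := Complex.I) (by simp [huniv])
  simpa only [charFun_apply, ProbabilityTheory.complexMGF, mul_comm Complex.I] using key

section GaussWeierstrass

variable {E : Type*} [NormedAddCommGroup E] [InnerProductSpace ℝ E] [FiniteDimensional ℝ E]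
  [MeasurableSpace E] [BorelSpace E]

theorem integrable_exp_neg_mul_sq_norm_add_inner {b : ℝ} (hb : 0 < b) (t : E) :
    Integrable (fun x : E ↦ Real.exp (-b * ‖x‖ ^ 2 + ⟪x, t⟫)) := by
  have h := GaussianFourier.integrable_cexp_neg_mul_sq_norm_add (V := E) (b := (b : ℂ))
    (by simpa using hb) 1 t
  refine h.norm.congr (.of_forall fun x ↦ ?_)
  simp only [Complex.norm_exp]
  congr 1
  rw [real_inner_comm]
  simp [← Complex.ofReal_pow]

theorem integrable_exp_neg_sq_norm_mul_of_le {G : E → ℝ} {K : ℝ} (hG : Continuous G)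
    (hG0 : ∀ y, 0 ≤ G y) (hGK : ∀ y, G y ≤ K * Real.exp (‖y‖ ^ 2 / 2)) (t : E) :
    Integrable (fun y : E ↦ Real.exp (-‖y‖ ^ 2) * G y * Real.exp ⟪y, t⟫) := by
  refine ((integrable_exp_neg_mul_sq_norm_add_inner one_half_pos t).const_mul K).mono'
    (by fun_prop) (.of_forall fun y ↦ ?_)
  rw [Real.norm_of_nonneg (by have := hG0 y; positivity)]
  calc Real.exp (-‖y‖ ^ 2) * G y * Real.exp ⟪y, t⟫
      ≤ Real.exp (-‖y‖ ^ 2) * (K * Real.exp (‖y‖ ^ 2 / 2)) * Real.exp ⟪y, t⟫ := by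
        gcongr; exact hGK y
    _ = K * (Real.exp (-‖y‖ ^ 2) * Real.exp (‖y‖ ^ 2 / 2) * Real.exp ⟪y, t⟫) := by ring
    _ = K * Real.exp (-(1 / 2) * ‖y‖ ^ 2 + ⟪y, t⟫) := by
        rw [← Real.exp_add, ← Real.exp_add]; congr 2; ring

/-- Injectivity of the Gauss–Weierstrass transform on nonnegative continuous functions of
controlled growth. -/
theorem eq_of_integral_exp_neg_sq_norm_add_mul_eq {G₁ G₂ : E → ℝ} {K₁ K₂ : ℝ}
    (hG₁ : Continuous G₁) (hG₂ : Continuous G₂) (hG₁0 : ∀ y, 0 ≤ G₁ y) (hG₂0 : ∀ y, 0 ≤ G₂ y)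
    (hG₁K : ∀ y, G₁ y ≤ K₁ * Real.exp (‖y‖ ^ 2 / 2))
    (hG₂K : ∀ y, G₂ y ≤ K₂ * Real.exp (‖y‖ ^ 2 / 2))
    (h : ∀ z : E, ∫ y, Real.exp (-‖y + z‖ ^ 2) * G₁ y = ∫ y, Real.exp (-‖y + z‖ ^ 2) * G₂ y) :
    G₁ = G₂ := by
  have transform (G : E → ℝ) (t : E) :
      ∫ y, Real.exp (-‖y + (-(1 / 2 : ℝ)) • t‖ ^ 2) * G y
        = Real.exp (-‖(-(1 / 2 : ℝ)) • t‖ ^ 2)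
          * ∫ y, Real.exp (-‖y‖ ^ 2) * G y * Real.exp ⟪y, t⟫ := by
    rw [← integral_const_mul]
    refine integral_congr_ae (.of_forall fun y ↦ ?_)
    have : Real.exp (-‖y + (-(1 / 2 : ℝ)) • t‖ ^ 2)
        = Real.exp (-‖(-(1 / 2 : ℝ)) • t‖ ^ 2) * (Real.exp (-‖y‖ ^ 2) * Real.exp ⟪y, t⟫) := by
      rw [← Real.exp_add, ← Real.exp_add, norm_add_sq_real, inner_smul_right]
      congr 1; ring
    simp only [this]; ring
  have hlap (t : E) : ∫ y, Real.exp (-‖y‖ ^ 2) * G₁ y * Real.exp ⟪y, t⟫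
      = ∫ y, Real.exp (-‖y‖ ^ 2) * G₂ y * Real.exp ⟪y, t⟫ := by
    have := h ((-(1 / 2 : ℝ)) • t)
    rw [transform, transform] at this
    exact mul_left_cancel₀ (Real.exp_ne_zero _) this
  have int₁ := integrable_exp_neg_sq_norm_mul_of_le hG₁ hG₁0 hG₁K
  have int₂ := integrable_exp_neg_sq_norm_mul_of_le hG₂ hG₂0 hG₂K
  have hm₁ : Measurable fun y : E ↦ ENNReal.ofReal (Real.exp (-‖y‖ ^ 2) * G₁ y) := by fun_prop
  have hm₂ : Measurable fun y : E ↦ ENNReal.ofReal (Real.exp (-‖y‖ ^ 2) * G₂ y) := by fun_prop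
  have fin₁ : ∫⁻ y : E, ENNReal.ofReal (Real.exp (-‖y‖ ^ 2) * G₁ y) ≠ ⊤ := by
    simpa using (int₁ 0).lintegral_lt_top.ne
  have fin₂ : ∫⁻ y : E, ENNReal.ofReal (Real.exp (-‖y‖ ^ 2) * G₂ y) ≠ ⊤ := by
    simpa using (int₂ 0).lintegral_lt_top.ne
  have := isFiniteMeasure_withDensity fin₁
  have := isFiniteMeasure_withDensity fin₂
  have hd₁ (y : E) : 0 ≤ Real.exp (-‖y‖ ^ 2) * G₁ y := mul_nonneg (Real.exp_nonneg _) (hG₁0 y)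
  have hd₂ (y : E) : 0 ≤ Real.exp (-‖y‖ ^ 2) * G₂ y := mul_nonneg (Real.exp_nonneg _) (hG₂0 y)
  have heq : volume.withDensity (fun y : E ↦ ENNReal.ofReal (Real.exp (-‖y‖ ^ 2) * G₁ y))
      = volume.withDensity (fun y : E ↦ ENNReal.ofReal (Real.exp (-‖y‖ ^ 2) * G₂ y)) := by
    refine Measure.ext_of_integral_exp_inner (fun t ↦ ?_) fun t ↦ ?_
    · rw [integrable_withDensity_iff_integrable_smul' hm₁ (by simp)]
      simpa only [ENNReal.toReal_ofReal (hd₁ _), smul_eq_mul] using int₁ t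
    · rw [integral_withDensity_eq_integral_toReal_smul hm₁ (by simp),
        integral_withDensity_eq_integral_toReal_smul hm₂ (by simp)]
      simpa only [ENNReal.toReal_ofReal (hd₁ _), ENNReal.toReal_ofReal (hd₂ _), smul_eq_mul]
        using hlap t
  rw [withDensity_eq_iff hm₁.aemeasurable hm₂.aemeasurable fin₁] at heq
  refine Measure.eq_of_ae_eq (μ := (volume : Measure E)) ?_ hG₁ hG₂
  filter_upwards [heq] with y hy
  rw [ENNReal.ofReal_eq_ofReal_iff (hd₁ y) (hd₂ y)] at hy
  exact mul_left_cancel₀ (Real.exp_ne_zero _) hy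

end GaussWeierstrass

/-- The hard-potential kernel `ρ ^ γ * q₀ θ` in the Cartesian coordinates
`(a, b) = (ρ * cos θ, ρ * sin θ)`. -/
def cartesianKernel (γ : ℝ) (q₀ : ℝ → ℝ) (a b : ℝ) : ℝ :=
  √(a ^ 2 + b ^ 2) ^ γ * q₀ (Real.arctan (b / a))

theorem arctan_div_mem_Icc {a b : ℝ} (ha : 0 < a) (hb : 0 ≤ b) :
    Real.arctan (b / a) ∈ Set.Icc 0 (π / 2) :=
  ⟨Real.arctan_nonneg.2 (by positivity), (Real.arctan_lt_pi_div_two _).le⟩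

theorem cartesianKernel_polar (γ : ℝ) (q₀ : ℝ → ℝ) {ρ θ : ℝ} (hρ : 0 < ρ)
    (hθ : θ ∈ Set.Ioo 0 (π / 2)) :
    cartesianKernel γ q₀ (ρ * Real.cos θ) (ρ * Real.sin θ) = ρ ^ γ * q₀ θ := by
  rw [cartesianKernel, mul_div_mul_left _ _ hρ.ne', ← Real.tan_eq_sin_div_cos,
    Real.arctan_tan (by linarith [hθ.1, Real.pi_pos]) hθ.2]
  congr 2
  rw [show (ρ * Real.cos θ) ^ 2 + (ρ * Real.sin θ) ^ 2 = ρ ^ 2 by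
    linear_combination ρ ^ 2 * Real.sin_sq_add_cos_sq θ, Real.sqrt_sq hρ.le]

theorem exists_polar_of_pos {a b : ℝ} (ha : 0 < a) (hb : 0 < b) :
    ∃ θ ∈ Set.Ioo 0 (π / 2), ∃ ρ > 0, ρ * Real.cos θ = a ∧ ρ * Real.sin θ = b := by
  refine ⟨Real.arctan (b / a), ⟨Real.arctan_pos.2 (by positivity), Real.arctan_lt_pi_div_two _⟩,
    a * √(1 + (b / a) ^ 2), by positivity, ?_, ?_⟩
  · rw [Real.cos_arctan]
    field_simp
  · rw [Real.sin_arctan]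
    field_simp

/-- A symmetric kernel agrees with its Cartesian representation. -/
theorem eq_cartesianKernel_of_symm {γ : ℝ} {q₀ : ℝ → ℝ} {qt : ℝ → ℝ → ℝ}
    (hsym : ∀ θ ∈ Set.Ioo 0 (π / 2), ∀ ρ > (0 : ℝ),
      ρ ^ γ * q₀ θ * Real.sin θ = ρ ^ γ * q₀ (π / 2 - θ) * Real.sin (π / 2 - θ))
    (hqt : ∀ θ ∈ Set.Ioo 0 (π / 2), ∀ ρ > (0 : ℝ),
      qt (ρ * Real.cos θ) (ρ * Real.sin θ)
        = (1 / 2 * (ρ ^ γ * q₀ θ * Real.sin θ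
            + ρ ^ γ * q₀ (π / 2 - θ) * Real.sin (π / 2 - θ))) / Real.sin θ)
    {a b : ℝ} (ha : 0 < a) (hb : 0 < b) : qt a b = cartesianKernel γ q₀ a b := by
  obtain ⟨θ, hθ, ρ, hρ, rfl, rfl⟩ := exists_polar_of_pos ha hb
  have hsin : Real.sin θ ≠ 0 := (pos_of_mul_pos_right hb hρ.le).ne'
  rw [hqt θ hθ ρ hρ, ← hsym θ hθ ρ hρ, cartesianKernel_polar γ q₀ hρ hθ]
  field_simp
  ring

theorem continuous_cartesianKernel_norm {F : Type*} [SeminormedAddCommGroup F] {γ : ℝ}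
    (hγ : 0 ≤ γ) {q₀ : ℝ → ℝ} (hq : ContinuousOn q₀ (Set.Icc 0 (π / 2))) {a : ℝ} (ha : 0 < a) :
    Continuous fun y : F ↦ cartesianKernel γ q₀ a ‖y‖ := by
  refine .mul (.rpow_const (by fun_prop) fun _ ↦ .inr hγ) ?_
  exact hq.comp_continuous (by fun_prop) fun y ↦ arctan_div_mem_Icc ha (norm_nonneg y)

theorem cartesianKernel_nonneg {γ : ℝ} {q₀ : ℝ → ℝ} (hq : ∀ θ ∈ Set.Icc 0 (π / 2), 0 ≤ q₀ θ)
    {a b : ℝ} (ha : 0 < a) (hb : 0 ≤ b) : 0 ≤ cartesianKernel γ q₀ a b :=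
  mul_nonneg (by positivity) (hq _ (arctan_div_mem_Icc ha hb))

theorem cartesianKernel_le {γ : ℝ} (hγ : γ ∈ Set.Icc (0 : ℝ) 1) {q₀ : ℝ → ℝ} {C : ℝ}
    (hq : ∀ θ ∈ Set.Icc 0 (π / 2), 0 ≤ q₀ θ ∧ q₀ θ ≤ C * Real.cos θ) (hC : 0 < C)
    {a b : ℝ} (ha : 0 < a) (hb : 0 ≤ b) :
    cartesianKernel γ q₀ a b ≤ C * Real.exp ((1 + a ^ 2) / 2) * Real.exp (b ^ 2 / 2) := by
  have hle : q₀ (Real.arctan (b / a)) ≤ C :=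
    (hq _ (arctan_div_mem_Icc ha hb)).2.trans (mul_le_of_le_one_right hC.le (Real.cos_le_one _))
  set r := √(a ^ 2 + b ^ 2)
  have hr0 : 0 ≤ r := Real.sqrt_nonneg _
  have hr2 : r ^ 2 = a ^ 2 + b ^ 2 := Real.sq_sqrt (by positivity)
  have hpow : r ^ γ ≤ 1 + r := by
    rcases le_total r 1 with h1 | h1
    · linarith [Real.rpow_le_one hr0 h1 hγ.1]
    · linarith [Real.rpow_le_self_of_one_le h1 hγ.2]
  have hexp : r ^ γ ≤ Real.exp ((1 + a ^ 2) / 2) * Real.exp (b ^ 2 / 2) := by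
    rw [← Real.exp_add]
    calc r ^ γ ≤ r + 1 := by linarith
      _ ≤ Real.exp r := Real.add_one_le_exp r
      _ ≤ _ := Real.exp_le_exp.2 (by nlinarith [sq_nonneg (r - 1)])
  calc cartesianKernel γ q₀ a b
      ≤ (Real.exp ((1 + a ^ 2) / 2) * Real.exp (b ^ 2 / 2)) * C := by
        unfold cartesianKernel
        exact mul_le_mul hexp hle (hq _ (arctan_div_mem_Icc ha hb)).1 (by positivity)
    _ = _ := by ring

/-- **The coefficients `ν` and `k₂` of the linearized Boltzmann equation determine the
collision kernel.** Let `q⁽ʲ⁾(θ,ρ) = ρ^{γⱼ} q₀⁽ʲ⁾(θ)` satisfy Grad's cutoff and the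
symmetry assumption `B⁽ʲ⁾(θ,ρ) = B⁽ʲ⁾(π/2−θ,ρ)` (`B(θ,ρ) = q(θ,ρ)sinθ`), with
Cartesian representations `q̃⁽ʲ⁾`. If the collision frequencies
`ν(v) = ∫_{ℝ³}∫_{S²} q(θ,|v−u|)e^{−|u|²} dω du` agree and the kernels
`k₂(u,v) = (2/|u−v|²)e^{−|u−v|²/4}∫_Π e^{−|y+ζ|²} q̃(|u−v|,|y|) dΠ(y)` agree, then
`q⁽¹⁾(θ,ρ) = q⁽²⁾(θ,ρ)` for all `θ ∈ (0,π/2)`, `ρ > 0`. -/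
theorem albedo_coefficients_determine_kernel
    (γ₁ γ₂ C : ℝ) (hγ₁ : γ₁ ∈ Set.Icc (0 : ℝ) 1) (hγ₂ : γ₂ ∈ Set.Icc (0 : ℝ) 1) (hC : 0 < C)
    (q₀₁ q₀₂ : ℝ → ℝ)
    (hq₀₁c : ContinuousOn q₀₁ (Set.Icc 0 (π / 2)))
    (hq₀₂c : ContinuousOn q₀₂ (Set.Icc 0 (π / 2)))
    (hq₀₁ : ∀ θ ∈ Set.Icc 0 (π / 2), 0 ≤ q₀₁ θ ∧ q₀₁ θ ≤ C * Real.cos θ)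
    (hq₀₂ : ∀ θ ∈ Set.Icc 0 (π / 2), 0 ≤ q₀₂ θ ∧ q₀₂ θ ≤ C * Real.cos θ)
    (hsym₁ : ∀ θ ∈ Set.Ioo 0 (π / 2), ∀ ρ > (0 : ℝ),
      ρ ^ γ₁ * q₀₁ θ * Real.sin θ = ρ ^ γ₁ * q₀₁ (π / 2 - θ) * Real.sin (π / 2 - θ))
    (hsym₂ : ∀ θ ∈ Set.Ioo 0 (π / 2), ∀ ρ > (0 : ℝ),
      ρ ^ γ₂ * q₀₂ θ * Real.sin θ = ρ ^ γ₂ * q₀₂ (π / 2 - θ) * Real.sin (π / 2 - θ))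
    (qt₁ qt₂ : ℝ → ℝ → ℝ)
    (hqt₁ : ∀ θ ∈ Set.Ioo 0 (π / 2), ∀ ρ > (0 : ℝ),
      qt₁ (ρ * Real.cos θ) (ρ * Real.sin θ)
        = (1 / 2 * (ρ ^ γ₁ * q₀₁ θ * Real.sin θ
            + ρ ^ γ₁ * q₀₁ (π / 2 - θ) * Real.sin (π / 2 - θ))) / Real.sin θ)
    (hqt₂ : ∀ θ ∈ Set.Ioo 0 (π / 2), ∀ ρ > (0 : ℝ),
      qt₂ (ρ * Real.cos θ) (ρ * Real.sin θ)
        = (1 / 2 * (ρ ^ γ₂ * q₀₂ θ * Real.sin θ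
            + ρ ^ γ₂ * q₀₂ (π / 2 - θ) * Real.sin (π / 2 - θ))) / Real.sin θ)
    (hν : ∀ v : EuclideanSpace ℝ (Fin 3),
      (∫ u : EuclideanSpace ℝ (Fin 3),
        ∫ ω : sphere (0 : EuclideanSpace ℝ (Fin 3)) 1,
          ‖v - u‖ ^ γ₁
            * q₀₁ (Real.arccos (|⟪v - u, (ω : EuclideanSpace ℝ (Fin 3))⟫| / ‖v - u‖))
            * Real.exp (-‖u‖ ^ 2)
          ∂((volume : Measure (EuclideanSpace ℝ (Fin 3))).toSphere))
      = ∫ u : EuclideanSpace ℝ (Fin 3),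
        ∫ ω : sphere (0 : EuclideanSpace ℝ (Fin 3)) 1,
          ‖v - u‖ ^ γ₂
            * q₀₂ (Real.arccos (|⟪v - u, (ω : EuclideanSpace ℝ (Fin 3))⟫| / ‖v - u‖))
            * Real.exp (-‖u‖ ^ 2)
          ∂((volume : Measure (EuclideanSpace ℝ (Fin 3))).toSphere))
    (hk : ∀ u v : EuclideanSpace ℝ (Fin 3), u ≠ v →
      (2 / ‖u - v‖ ^ 2) * Real.exp (-‖u - v‖ ^ 2 / 4) *
        ∫ y : ((ℝ ∙ (u - v))ᗮ),
          Real.exp (-‖(y : EuclideanSpace ℝ (Fin 3)) + (2⁻¹ : ℝ) • (u + v)‖ ^ 2)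
            * qt₁ ‖u - v‖ ‖(y : EuclideanSpace ℝ (Fin 3))‖
      = (2 / ‖u - v‖ ^ 2) * Real.exp (-‖u - v‖ ^ 2 / 4) *
        ∫ y : ((ℝ ∙ (u - v))ᗮ),
          Real.exp (-‖(y : EuclideanSpace ℝ (Fin 3)) + (2⁻¹ : ℝ) • (u + v)‖ ^ 2)
            * qt₂ ‖u - v‖ ‖(y : EuclideanSpace ℝ (Fin 3))‖) :
    ∀ θ ∈ Set.Ioo 0 (π / 2), ∀ ρ > (0 : ℝ),
      ρ ^ γ₁ * q₀₁ θ = ρ ^ γ₂ * q₀₂ θ := by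
  intro θ hθ ρ hρ
  have hcos : 0 < Real.cos θ := Real.cos_pos_of_mem_Ioo ⟨by linarith [hθ.1, Real.pi_pos], hθ.2⟩
  have hsin : 0 < Real.sin θ := Real.sin_pos_of_pos_of_lt_pi hθ.1 (by linarith [hθ.2, Real.pi_pos])
  set a := ρ * Real.cos θ
  set b := ρ * Real.sin θ
  have ha : 0 < a := by positivity
  have hb : 0 < b := by positivity
  set w : EuclideanSpace ℝ (Fin 3) := EuclideanSpace.single 0 a with hw
  have hwn : ‖w‖ = a := by simp [hw, abs_of_pos ha]
  have hw0 : w ≠ 0 := norm_ne_zero_iff.1 (by rw [hwn]; exact ha.ne')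
  let y₀ : ((ℝ ∙ w)ᗮ : Submodule ℝ (EuclideanSpace ℝ (Fin 3))) :=
    ⟨EuclideanSpace.single 1 b, Submodule.mem_orthogonal_singleton_iff_inner_right.2 (by
      simp [hw, EuclideanSpace.inner_single_left])⟩
  have hy₀ : ‖y₀‖ = b := by simp [y₀, abs_of_pos hb]
  have : Nontrivial ((ℝ ∙ w)ᗮ : Submodule ℝ (EuclideanSpace ℝ (Fin 3))) :=
    ⟨y₀, 0, norm_ne_zero_iff.1 (by rw [hy₀]; exact hb.ne')⟩
  have hae {γ : ℝ} {q₀ : ℝ → ℝ} {qt : ℝ → ℝ → ℝ}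
      (hqt : ∀ s > 0, qt a s = cartesianKernel γ q₀ a s) (z : ((ℝ ∙ w)ᗮ)) :
      ∫ y : ((ℝ ∙ w)ᗮ), Real.exp (-‖(y : EuclideanSpace ℝ (Fin 3)) + z‖ ^ 2)
          * qt a ‖(y : EuclideanSpace ℝ (Fin 3))‖
        = ∫ y : ((ℝ ∙ w)ᗮ), Real.exp (-‖y + z‖ ^ 2) * cartesianKernel γ q₀ a ‖y‖ := by
    refine integral_congr_ae ?_
    filter_upwards [Measure.ae_ne volume (0 : ((ℝ ∙ w)ᗮ))] with y hy
    have := hqt ‖y‖ (norm_pos_iff.2 hy)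
    simp only [Submodule.coe_norm, Submodule.coe_add] at this ⊢
    rw [this]
  have heq := eq_of_integral_exp_neg_sq_norm_add_mul_eq
    (continuous_cartesianKernel_norm (F := ((ℝ ∙ w)ᗮ)) hγ₁.1 hq₀₁c ha)
    (continuous_cartesianKernel_norm hγ₂.1 hq₀₂c ha)
    (fun y ↦ cartesianKernel_nonneg (fun θ hθ ↦ (hq₀₁ θ hθ).1) ha (norm_nonneg y))
    (fun y ↦ cartesianKernel_nonneg (fun θ hθ ↦ (hq₀₂ θ hθ).1) ha (norm_nonneg y))
    (fun y ↦ cartesianKernel_le hγ₁ hq₀₁ hC ha (norm_nonneg y))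
    (fun y ↦ cartesianKernel_le hγ₂ hq₀₂ hC ha (norm_nonneg y))
    (fun z ↦ by
      rw [← hae (fun s hs ↦ eq_cartesianKernel_of_symm hsym₁ hqt₁ ha hs) z,
        ← hae (fun s hs ↦ eq_cartesianKernel_of_symm hsym₂ hqt₂ ha hs) z]
      have hsub : ((z : EuclideanSpace ℝ (Fin 3)) + (2⁻¹ : ℝ) • w) - (z - (2⁻¹ : ℝ) • w) = w := by
        module
      have hmid : (2⁻¹ : ℝ) • (((z : EuclideanSpace ℝ (Fin 3)) + (2⁻¹ : ℝ) • w)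
          + (z - (2⁻¹ : ℝ) • w)) = z := by
        module
      have hz := hk (z + (2⁻¹ : ℝ) • w) (z - (2⁻¹ : ℝ) • w)
        (sub_ne_zero.1 (by rw [hsub]; exact hw0))
      rw [hmid, hsub, hwn] at hz
      exact mul_left_cancel₀ (by positivity) hz)
  have hb_eq := congrFun heq y₀
  simp only [hy₀] at hb_eq
  rwa [cartesianKernel_polar γ₁ q₀₁ hρ hθ, cartesianKernel_polar γ₂ q₀₂ hρ hθ] at hb_eq
end
end
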